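/- arXiv:2510.09054 — 3 statements merged into one kernel-verified Lean document; each statement's English description precedes it below -/
import Mathlib

section
/- Define q₁, r₁, u₁ : ℝ² → ℝ by q₁(x,t) = r₁(x,t) = √2 / (2·cosh(x+t)) and u₁(x,t) = 3 / (1 + cosh(2x+2t)). Then (u₁, q₁, r₁) satisfies the system (def1Vqru): u₁ₜ = 3 q₁ r₁ₓ + 3 q₁ₓ r₁; q₁ₜ = q₁ₓₓₓ + 2 u₁ q₁ₓ + q₁ u₁ₓ; r₁ₜ = r₁ₓₓₓ + 2 u₁ r₁ₓ + r₁ u₁ₓ. -/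
/-- Partial derivative in the first (spatial) variable of a function `ℝ² → ℝ`
written in curried form. -/
noncomputable def pdx (f : ℝ → ℝ → ℝ) : ℝ → ℝ → ℝ := fun x t => deriv (fun y => f y t) x

/-- Partial derivative in the second (time) variable. -/
noncomputable def pdt (f : ℝ → ℝ → ℝ) : ℝ → ℝ → ℝ := fun x t => deriv (fun s => f x s) t

theorem pdx_travelling_wave {g g' : ℝ → ℝ} (hg : ∀ z, HasDerivAt g (g' z) z) :
    pdx (fun x t => g (x + t)) = fun x t => g' (x + t) := by
  funext x t
  exact ((hg (x + t)).comp_add_const x t).deriv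

theorem pdt_travelling_wave {g g' : ℝ → ℝ} (hg : ∀ z, HasDerivAt g (g' z) z) :
    pdt (fun x t => g (x + t)) = fun x t => g' (x + t) := by
  funext x t
  exact ((hg (x + t)).comp_const_add x t).deriv

theorem hasDerivAt_const_div_cosh_pow (a : ℝ) (n : ℕ) (z : ℝ) :
    HasDerivAt (fun z => a / Real.cosh z ^ n)
      (-(n * a * Real.sinh z / Real.cosh z ^ (n + 1))) z := by
  have hc : Real.cosh z ≠ 0 := (Real.cosh_pos z).ne'
  refine ((hasDerivAt_const z a).div ((Real.hasDerivAt_cosh z).pow n)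
    (pow_ne_zero n hc)).congr_deriv ?_
  cases n with
  | zero => simp
  | succ n =>
    simp only [Pi.pow_apply, Nat.add_sub_cancel]
    field_simp
    ring

theorem hasDerivAt_sinh_div_cosh_sq (a z : ℝ) :
    HasDerivAt (fun z => -(a * Real.sinh z / Real.cosh z ^ 2))
      (a / Real.cosh z ^ 1 - 2 * a / Real.cosh z ^ 3) z := by
  have hc : Real.cosh z ≠ 0 := (Real.cosh_pos z).ne'
  refine ((((Real.hasDerivAt_sinh z).const_mul a).div ((Real.hasDerivAt_cosh z).pow 2)
    (pow_ne_zero 2 hc)).neg).congr_deriv ?_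
  simp only [Pi.pow_apply]
  field_simp
  linear_combination 2 * a * Real.cosh z * Real.sinh_sq z

/-- `q₁ = r₁ = √2/(2 cosh(x+t))`, `u₁ = 3/(1 + cosh(2x+2t))` solves the
third flow (def1Vqru) of the matrix constrained CKP hierarchy with `m = n = 1`. -/
theorem explicit_solution_def1Vqru
    (q₁ r₁ u₁ : ℝ → ℝ → ℝ)
    (hq : ∀ x t, q₁ x t = Real.sqrt 2 / (2 * Real.cosh (x + t)))
    (hr : ∀ x t, r₁ x t = Real.sqrt 2 / (2 * Real.cosh (x + t)))
    (hu : ∀ x t, u₁ x t = 3 / (1 + Real.cosh (2 * x + 2 * t))) :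
    (∀ x t, pdt u₁ x t = 3 * q₁ x t * pdx r₁ x t + 3 * pdx q₁ x t * r₁ x t) ∧
    (∀ x t, pdt q₁ x t = pdx (pdx (pdx q₁)) x t
      + 2 * u₁ x t * pdx q₁ x t + q₁ x t * pdx u₁ x t) ∧
    (∀ x t, pdt r₁ x t = pdx (pdx (pdx r₁)) x t
      + 2 * u₁ x t * pdx r₁ x t + r₁ x t * pdx u₁ x t) := by
  have hq' : q₁ = fun x t => Real.sqrt 2 / 2 / Real.cosh (x + t) ^ 1 := by
    funext x t
    rw [hq, pow_one, div_div]
  have hr' : r₁ = q₁ := by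
    funext x t
    rw [hr, hq]
  have hu' : u₁ = fun x t => 3 / 2 / Real.cosh (x + t) ^ 2 := by
    funext x t
    rw [hu, ← mul_add, Real.cosh_two_mul, Real.sinh_sq, div_div]
    congr 1
    ring
  clear hq hr hu
  subst hr'
  have h₁ (z : ℝ) : HasDerivAt (fun z => Real.sqrt 2 / 2 / Real.cosh z ^ 1)
      (-(Real.sqrt 2 / 2 * Real.sinh z / Real.cosh z ^ 2)) z := by
    simpa only [Nat.cast_one, one_mul] using
      hasDerivAt_const_div_cosh_pow (Real.sqrt 2 / 2) 1 z
  have h₂ := hasDerivAt_sinh_div_cosh_sq (Real.sqrt 2 / 2)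
  have h₃ (z : ℝ) := (h₁ z).sub (hasDerivAt_const_div_cosh_pow (2 * (Real.sqrt 2 / 2)) 3 z)
  have hU := hasDerivAt_const_div_cosh_pow (3 / 2) 2
  have hqx := pdx_travelling_wave h₁
  have hqt := pdt_travelling_wave h₁
  have hqxx := pdx_travelling_wave h₂
  have hqxxx := pdx_travelling_wave h₃
  have hux := pdx_travelling_wave hU
  have hut := pdt_travelling_wave hU
  simp only [Pi.sub_apply] at hqxxx
  rw [← hq'] at hqx hqt
  rw [← hqx] at hqxx
  rw [← hqxx] at hqxxx
  rw [← hu'] at hux hut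
  have hsqrt : Real.sqrt 2 ^ 2 = 2 := Real.sq_sqrt (by norm_num)
  have hqeq (x t : ℝ) : pdt r₁ x t = pdx (pdx (pdx r₁)) x t
      + 2 * u₁ x t * pdx r₁ x t + r₁ x t * pdx u₁ x t := by
    have hc : Real.cosh (x + t) ≠ 0 := (Real.cosh_pos _).ne'
    rw [hqxxx, hqt, hqx, hux, hu', hq']
    push_cast
    field_simp
    ring
  refine ⟨fun x t => ?_, hqeq, hqeq⟩
  have hc : Real.cosh (x + t) ≠ 0 := (Real.cosh_pos _).ne'
  rw [hut, hqx, hq']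
  push_cast
  field_simp
  rw [hsqrt]
  ring
end

section
/- Define a, b, q₁, r₁ : ℝ² → ℝ by q₁(x,t) = r₁(x,t) = √2·e^{−x−t} / (1 + e^{−2x−2t}), a(x,t) = 2·e^{−2x−2t} / (1 + e^{−2x−2t}), and b = −a. Then (a, b, q₁, r₁) satisfies the system (def1Yqrab): a_t = −2 q₁ r₁; b_t = 2 a q₁ r₁ − q₁ₓ r₁ − q₁ r₁ₓ; q₁ₜ = q₁ₓₓₓ − 2(aₓ + b + a²/2) q₁ₓ − q₁ (aₓ + b + a²/2)ₓ; r₁ₜ = r₁ₓₓₓ − 2(aₓ + b + a²/2) r₁ₓ − r₁ (aₓ + b + a²/2)ₓ. -/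
theorem hasDerivAt_sech_profile {u : ℝ → ℝ} {y : ℝ} (c : ℝ) (hu : HasDerivAt u (-u y) y) :
    HasDerivAt (fun z => c * u z / (1 + u z ^ 2))
      (c * u y / (1 + u y ^ 2) * (2 * u y ^ 2 / (1 + u y ^ 2) - 1)) y := by
  have h : 1 + u y ^ 2 ≠ 0 := by positivity
  refine ((hu.const_mul c).div ((hu.pow 2).const_add 1) h).congr_deriv ?_
  simp only [Pi.pow_apply]
  field_simp
  ring

theorem hasDerivAt_tanh_profile {u : ℝ → ℝ} {y : ℝ} (hu : HasDerivAt u (-u y) y) :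
    HasDerivAt (fun z => 2 * u z ^ 2 / (1 + u z ^ 2))
      (-2 * (Real.sqrt 2 * u y / (1 + u y ^ 2)) ^ 2) y := by
  have h : 1 + u y ^ 2 ≠ 0 := by positivity
  have h2 : Real.sqrt 2 ^ 2 = 2 := Real.sq_sqrt (by norm_num)
  refine (((hu.pow 2).const_mul 2).div ((hu.pow 2).const_add 1) h).congr_deriv ?_
  simp only [Pi.pow_apply]
  rw [div_pow, mul_pow, h2]
  field_simp
  ring

theorem exp_neg_two_mul_sub (x t : ℝ) : Real.exp (-2*x - 2*t) = Real.exp (-x - t) ^ 2 := by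
  rw [← Real.exp_nat_mul]
  congr 1
  push_cast
  ring

/-- `q₁ = r₁ = √2 e^{-x-t}/(1+e^{-2x-2t})`, `a = 2e^{-2x-2t}/(1+e^{-2x-2t})`,
`b = -a` solves the third flow (def1Yqrab) of the `𝒢_{1,1}`-hierarchy. -/
theorem explicit_solution_def1Yqrab
    (a b q₁ r₁ : ℝ → ℝ → ℝ)
    (hq : ∀ x t, q₁ x t = Real.sqrt 2 * Real.exp (-x - t) / (1 + Real.exp (-2*x - 2*t)))
    (hr : ∀ x t, r₁ x t = Real.sqrt 2 * Real.exp (-x - t) / (1 + Real.exp (-2*x - 2*t)))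
    (hA : ∀ x t, a x t = 2 * Real.exp (-2*x - 2*t) / (1 + Real.exp (-2*x - 2*t)))
    (hB : ∀ x t, b x t = -a x t) :
    (∀ x t, pdt a x t = -2 * q₁ x t * r₁ x t) ∧
    (∀ x t, pdt b x t =
      2 * a x t * q₁ x t * r₁ x t - pdx q₁ x t * r₁ x t - q₁ x t * pdx r₁ x t) ∧
    (∀ x t, pdt q₁ x t = pdx (pdx (pdx q₁)) x t
      - 2 * (pdx a x t + b x t + (a x t)^2 / 2) * pdx q₁ x t
      - q₁ x t * pdx (fun y s => pdx a y s + b y s + (a y s)^2 / 2) x t) ∧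
    (∀ x t, pdt r₁ x t = pdx (pdx (pdx r₁)) x t
      - 2 * (pdx a x t + b x t + (a x t)^2 / 2) * pdx r₁ x t
      - r₁ x t * pdx (fun y s => pdx a y s + b y s + (a y s)^2 / 2) x t) := by
  obtain rfl : r₁ = q₁ := by
    funext x t
    rw [hq, hr]
  obtain rfl : b = fun x t => -a x t := by
    funext x t
    exact hB x t
  simp only [exp_neg_two_mul_sub] at hq hA
  have hux (x t : ℝ) : HasDerivAt (fun y => Real.exp (-y - t)) (-Real.exp (-x - t)) x := by
    simpa using ((hasDerivAt_id x).neg.sub_const t).exp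
  have hut (x t : ℝ) : HasDerivAt (fun s => Real.exp (-x - s)) (-Real.exp (-x - t)) t := by
    simpa using ((hasDerivAt_id t).const_sub (-x)).exp
  have hqx (x t : ℝ) : HasDerivAt (fun y => r₁ y t) (r₁ x t * (a x t - 1)) x := by
    simpa only [hq, hA] using hasDerivAt_sech_profile (Real.sqrt 2) (hux x t)
  have hqt (x t : ℝ) : HasDerivAt (fun s => r₁ x s) (r₁ x t * (a x t - 1)) t := by
    simpa only [hq, hA] using hasDerivAt_sech_profile (Real.sqrt 2) (hut x t)
  have hax (x t : ℝ) : HasDerivAt (fun y => a y t) (-2 * r₁ x t ^ 2) x := by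
    simpa only [hq, hA] using hasDerivAt_tanh_profile (hux x t)
  have hat (x t : ℝ) : HasDerivAt (fun s => a x s) (-2 * r₁ x t ^ 2) t := by
    simpa only [hq, hA] using hasDerivAt_tanh_profile (hut x t)
  have hrel (x t : ℝ) : 2 * r₁ x t ^ 2 = 2 * a x t - a x t ^ 2 := by
    have h2 : Real.sqrt 2 ^ 2 = 2 := Real.sq_sqrt (by norm_num)
    rw [hq, hA, div_pow, mul_pow, h2]
    field_simp
    ring
  have hpqx : pdx r₁ = fun x t => r₁ x t * (a x t - 1) := by
    funext x t
    exact (hqx x t).deriv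
  have hpqt : pdt r₁ = fun x t => r₁ x t * (a x t - 1) := by
    funext x t
    exact (hqt x t).deriv
  have hpax : pdx a = fun x t => -2 * r₁ x t ^ 2 := by
    funext x t
    exact (hax x t).deriv
  have hpqxx : pdx (pdx r₁) = fun x t => r₁ x t - 4 * r₁ x t ^ 3 := by
    funext x t
    rw [hpqx]
    refine ((hqx x t).mul ((hax x t).sub_const 1)).deriv.trans ?_
    linear_combination r₁ x t * hrel x t
  have hpqxxx : pdx (pdx (pdx r₁)) =
      fun x t => (1 - 12 * r₁ x t ^ 2) * (r₁ x t * (a x t - 1)) := by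
    funext x t
    rw [hpqxx]
    refine ((hqx x t).sub (((hqx x t).pow 3).const_mul 4)).deriv.trans ?_
    push_cast
    ring
  have hV : (fun y s => pdx a y s + -a y s + (a y s) ^ 2 / 2) = fun y s => -3 * r₁ y s ^ 2 := by
    funext y s
    rw [hpax]
    linear_combination (1 / 2) * hrel y s
  have hpV : pdx (fun y s => -3 * r₁ y s ^ 2) =
      fun x t => -6 * r₁ x t ^ 2 * (a x t - 1) := by
    funext x t
    refine (((hqx x t).pow 2).const_mul (-3)).deriv.trans ?_
    push_cast
    ring
  have hflow (x t : ℝ) : pdt r₁ x t = pdx (pdx (pdx r₁)) x t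
      - 2 * (pdx a x t + -a x t + (a x t) ^ 2 / 2) * pdx r₁ x t
      - r₁ x t * pdx (fun y s => pdx a y s + -a y s + (a y s) ^ 2 / 2) x t := by
    rw [hpqxxx, hV, hpV, congrFun (congrFun hV x) t, hpqt, hpqx]
    ring
  refine ⟨fun x t => ?_, fun x t => ?_, hflow, hflow⟩
  · refine (hat x t).deriv.trans ?_
    ring
  · rw [hpqx]
    refine (hat x t).neg.deriv.trans ?_
    ring
end

section
/- Define a, b, q₁, r₁ : ℝ² → ℝ by q₁(x,t) = e^{−x−t} / (1 + e^{−2x−2t}), r₁(x,t) = 2·e^{−x−t} / (1 + e^{−2x−2t}), a(x,t) = 2·e^{−2x−2t} / (1 + e^{−2x−2t}), and b = −a. Then (a, b, q₁, r₁) satisfies the system (def1Yqrab): a_t = −2 q₁ r₁; b_t = 2 a q₁ r₁ − q₁ₓ r₁ − q₁ r₁ₓ; q₁ₜ = q₁ₓₓₓ − 2(aₓ + b + a²/2) q₁ₓ − q₁ (aₓ + b + a²/2)ₓ; r₁ₜ = r₁ₓₓₓ − 2(aₓ + b + a²/2) r₁ₓ − r₁ (aₓ + b + a²/2)ₓ.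 -/
theorem hasDerivAt_half_sech {q a : ℝ → ℝ} (c : ℝ)
    (hq : ∀ u, q u = Real.exp (-u - c) / (1 + Real.exp (-2*u - 2*c)))
    (ha : ∀ u, a u = 2 * Real.exp (-2*u - 2*c) / (1 + Real.exp (-2*u - 2*c))) (u : ℝ) :
    HasDerivAt q (-(q u * (1 - a u))) u ∧ HasDerivAt a (-(4 * q u ^ 2)) u ∧
      (1 - a u) ^ 2 = 1 - 4 * q u ^ 2 := by
  have hsq : Real.exp (-2*u - 2*c) = Real.exp (-u - c) ^ 2 := by
    rw [← Real.exp_nat_mul]; congr 1; push_cast; ring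
  have hpos : 1 + Real.exp (-2*u - 2*c) ≠ 0 := by positivity
  have hpos' : 1 + Real.exp (-u - c) ^ 2 ≠ 0 := by positivity
  have hnum : HasDerivAt (fun y => Real.exp (-y - c)) (Real.exp (-u - c) * (-1)) u :=
    ((hasDerivAt_id u).neg.sub_const c).exp
  have hden : HasDerivAt (fun y => Real.exp (-2*y - 2*c))
      (Real.exp (-2*u - 2*c) * (-2 * 1)) u :=
    (((hasDerivAt_id u).const_mul (-2)).sub_const (2*c)).exp
  refine ⟨?_, ?_, ?_⟩
  · rw [hq, ha, funext hq]
    refine (hnum.div (hden.const_add 1) hpos).congr_deriv ?_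
    rw [hsq]; field_simp; ring
  · rw [hq, funext ha]
    refine ((hden.const_mul 2).div (hden.const_add 1) hpos).congr_deriv ?_
    rw [hsq]; field_simp; ring
  · rw [hq, ha, hsq]; field_simp; ring

/-- `q₁ = e^{-x-t}/(1+e^{-2x-2t})`, `r₁ = 2e^{-x-t}/(1+e^{-2x-2t})`, `a = 2e^{-2x-2t}/(1+e^{-2x-2t})`,
`b = -a` solves the third flow (def1Yqrab) of the `𝒢_{1,1}`-hierarchy. -/
theorem soliton_solution_def1Yqrab
    (a b q₁ r₁ : ℝ → ℝ → ℝ)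
    (hq : ∀ x t, q₁ x t = Real.exp (-x - t) / (1 + Real.exp (-2*x - 2*t)))
    (hr : ∀ x t, r₁ x t = 2 * Real.exp (-x - t) / (1 + Real.exp (-2*x - 2*t)))
    (hA : ∀ x t, a x t = 2 * Real.exp (-2*x - 2*t) / (1 + Real.exp (-2*x - 2*t)))
    (hB : ∀ x t, b x t = -a x t) :
    (∀ x t, pdt a x t = -2 * q₁ x t * r₁ x t) ∧
    (∀ x t, pdt b x t =
      2 * a x t * q₁ x t * r₁ x t - pdx q₁ x t * r₁ x t - q₁ x t * pdx r₁ x t) ∧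
    (∀ x t, pdt q₁ x t = pdx (pdx (pdx q₁)) x t
      - 2 * (pdx a x t + b x t + (a x t)^2 / 2) * pdx q₁ x t
      - q₁ x t * pdx (fun y s => pdx a y s + b y s + (a y s)^2 / 2) x t) ∧
    (∀ x t, pdt r₁ x t = pdx (pdx (pdx r₁)) x t
      - 2 * (pdx a x t + b x t + (a x t)^2 / 2) * pdx r₁ x t
      - r₁ x t * pdx (fun y s => pdx a y s + b y s + (a y s)^2 / 2) x t) := by
  have hx : ∀ x t, HasDerivAt (fun y => q₁ y t) (-(q₁ x t * (1 - a x t))) x ∧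
      HasDerivAt (fun y => a y t) (-(4 * q₁ x t ^ 2)) x ∧
      (1 - a x t) ^ 2 = 1 - 4 * q₁ x t ^ 2 := fun x t =>
    hasDerivAt_half_sech (q := fun y => q₁ y t) (a := fun y => a y t) t
      (fun y => hq y t) (fun y => hA y t) x
  have ht : ∀ x t, HasDerivAt (fun s => q₁ x s) (-(q₁ x t * (1 - a x t))) t ∧
      HasDerivAt (fun s => a x s) (-(4 * q₁ x t ^ 2)) t ∧
      (1 - a x t) ^ 2 = 1 - 4 * q₁ x t ^ 2 := fun x t =>
    hasDerivAt_half_sech (q := fun s => q₁ x s) (a := fun s => a x s) x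
      (fun s => by rw [hq]; ring_nf) (fun s => by rw [hA]; ring_nf) t
  obtain rfl : b = fun x t => -a x t := funext₂ hB
  obtain rfl : r₁ = fun x t => 2 * q₁ x t := by
    funext x t; rw [hr, hq]; ring
  have hqx : pdx q₁ = fun x t => -(q₁ x t * (1 - a x t)) := funext₂ fun x t => (hx x t).1.deriv
  have hqxx : pdx (pdx q₁) = fun x t => q₁ x t - 8 * q₁ x t ^ 3 := by
    funext x t
    rw [hqx]
    refine (((hx x t).1.mul ((hx x t).2.1.const_sub 1)).neg.congr_deriv ?_).deriv
    linear_combination q₁ x t * (hx x t).2.2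
  have hqxxx : pdx (pdx (pdx q₁)) =
      fun x t => -(q₁ x t * (1 - a x t)) * (1 - 24 * q₁ x t ^ 2) := by
    funext x t
    rw [hqxx]
    refine (((hx x t).1.sub (((hx x t).1.pow 3).const_mul 8)).congr_deriv ?_).deriv
    push_cast; ring
  have hax : pdx a = fun x t => -(4 * q₁ x t ^ 2) := funext₂ fun x t => (hx x t).2.1.deriv
  have hV : (fun y s => pdx a y s + -a y s + (a y s)^2 / 2) = fun y s => -(6 * q₁ y s ^ 2) := by
    funext y s
    rw [hax]
    linear_combination (hx y s).2.2 / 2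
  have hVx : pdx (fun y s => -(6 * q₁ y s ^ 2)) =
      fun x t => 12 * q₁ x t ^ 2 * (1 - a x t) := by
    funext x t
    refine ((((hx x t).1.pow 2).const_mul 6).neg.congr_deriv ?_).deriv
    push_cast; ring
  have pdx_two_mul : ∀ f : ℝ → ℝ → ℝ, pdx (fun x t => 2 * f x t) = fun x t => 2 * pdx f x t :=
    fun f => funext₂ fun x t => deriv_const_mul_field 2
  have hqt : ∀ x t, pdt q₁ x t = -(q₁ x t * (1 - a x t)) := fun x t => (ht x t).1.deriv
  have hrt : ∀ x t, pdt (fun x t => 2 * q₁ x t) x t = 2 * pdt q₁ x t :=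
    fun x t => deriv_const_mul_field 2
  have hVeq : ∀ x t, pdx a x t + -a x t + (a x t)^2 / 2 = -(6 * q₁ x t ^ 2) :=
    fun x t => congrFun₂ hV x t
  refine ⟨fun x t => ?_, fun x t => ?_, fun x t => ?_, fun x t => ?_⟩
  · exact (ht x t).2.1.deriv.trans (by ring)
  · rw [pdx_two_mul, hqx]
    exact (ht x t).2.1.neg.deriv.trans (by ring)
  · simp only [hVx, hVeq, hqxxx, hqt]
    rw [hqx]; ring
  · simp only [hVx, hVeq, pdx_two_mul, hqxxx, hrt, hqt]
    rw [hqx]; ring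
end
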